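/- The ideal J_p intersects L_{p,1} trivially, and for every k ≥ 2 one has dim_K(J_p ∩ L_{p,k}) ≤ p · Σ_{j=0}^{k−2} (p−1)^{k−2−j} · C(j+p−2, j), where C(·,·) denotes the binomial coefficient. -/

import Mathlib

namespace Paper

variable (K : Type) [Field K] (p : ℕ)

abbrev Idx (p : ℕ) : Type := (ZMod p)ˣ ⊕ (ZMod p)ˣ

/-- The Lie ideal of the free Lie algebra generated by the `v`-generators. -/
noncomputable def vIdealFree : LieIdeal K (FreeLieAlgebra K (Idx p)) :=
  LieSubmodule.lieSpan K _ (Set.range fun i => FreeLieAlgebra.of K (Sum.inr i : Idx p))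

noncomputable def rels : Set (FreeLieAlgebra K (Idx p)) :=
  { z : FreeLieAlgebra K (Idx p) | ∃ i j : (ZMod p)ˣ,
      z = ⁅FreeLieAlgebra.of K (Sum.inl i : Idx p), FreeLieAlgebra.of K (Sum.inl j : Idx p)⁆ } ∪
  { z : FreeLieAlgebra K (Idx p) | ∃ u ∈ vIdealFree K p, ∃ w ∈ vIdealFree K p, z = ⁅u, w⁆ }

noncomputable def relIdeal : LieIdeal K (FreeLieAlgebra K (Idx p)) :=
  LieSubmodule.lieSpan K _ (rels K p)

abbrev Lp : Type := FreeLieAlgebra K (Idx p) ⧸ relIdeal K p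

noncomputable def gen (x : Idx p) : Lp K p :=
  LieSubmodule.Quotient.mk (N := relIdeal K p) (FreeLieAlgebra.of K x)

noncomputable def aGen (i : (ZMod p)ˣ) : Lp K p := gen K p (Sum.inl i)
noncomputable def vGen (i : (ZMod p)ˣ) : Lp K p := gen K p (Sum.inr i)

/-- Left-normed bracket `[x, l₁, l₂, …]` in the generators. -/
noncomputable def lnb (x : Idx p) (l : List (Idx p)) : Lp K p :=
  l.foldl (fun b y => ⁅b, gen K p y⁆) (gen K p x)

/-- Degree-`k` homogeneous component: the span of left-normed brackets of length `k`. -/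
noncomputable def homog (k : ℕ) : Submodule K (Lp K p) :=
  Submodule.span K { z | ∃ x l, l.length + 1 = k ∧ z = lnb K p x l }

/-- Fixed-point subspace of a Lie algebra automorphism. -/
noncomputable def fixedSubmodule (e : Lp K p ≃ₗ⁅K⁆ Lp K p) : Submodule K (Lp K p) where
  carrier := { x | e x = x }
  add_mem' := by
    intro a b ha hb
    simp only [Set.mem_setOf_eq] at *
    rw [show e (a + b) = e a + e b from map_add e.toLinearEquiv a b, ha, hb]
  zero_mem' := by
    simp only [Set.mem_setOf_eq]
    rw [show e 0 = 0 from map_zero e.toLinearEquiv]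
  smul_mem' := by
    intro c a ha
    simp only [Set.mem_setOf_eq] at *
    rw [show e (c • a) = c • e a from map_smul e.toLinearEquiv c a, ha]

/-- Eigenspace of a Lie algebra automorphism for the eigenvalue `c`. -/
noncomputable def eigSp (e : Lp K p ≃ₗ⁅K⁆ Lp K p) (c : K) : Submodule K (Lp K p) where
  carrier := { x | e x = c • x }
  add_mem' := by
    intro a b ha hb
    simp only [Set.mem_setOf_eq] at *
    rw [show e (a + b) = e a + e b from map_add e.toLinearEquiv a b, ha, hb, smul_add]
  zero_mem' := by
    simp only [Set.mem_setOf_eq]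
    rw [show e 0 = 0 from map_zero e.toLinearEquiv, smul_zero]
  smul_mem' := by
    intro d a ha
    simp only [Set.mem_setOf_eq] at *
    rw [show e (d • a) = d • e a from map_smul e.toLinearEquiv d a, ha, smul_comm]


/-- The derived subalgebra of the fixed-point subspace of `h`. -/
noncomputable def derivedFixed (K : Type) [Field K] (p : ℕ) (h : Lp K p ≃ₗ⁅K⁆ Lp K p) :
    LieSubalgebra K (Lp K p) :=
  LieSubalgebra.lieSpan K (Lp K p)
    { z : Lp K p | ∃ x ∈ fixedSubmodule K p h, ∃ y ∈ fixedSubmodule K p h, z = ⁅x, y⁆ }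

/-- `J_p`: the smallest Lie ideal of `L_p` containing `[C_{L_p}(h), C_{L_p}(h)]` and invariant
under both `f` and `h`. -/
noncomputable def Jp (K : Type) [Field K] (p : ℕ) (f h : Lp K p ≃ₗ⁅K⁆ Lp K p) :
    LieIdeal K (Lp K p) :=
  sInf { J : LieIdeal K (Lp K p) |
    (∀ z ∈ derivedFixed K p h, z ∈ J) ∧ (∀ x ∈ J, f x ∈ J) ∧ (∀ x ∈ J, h x ∈ J) }

/-- The affine Lie algebra `R ⋉ R` of a commutative ring `R`. -/
@[ext]
structure Aff (R : Type*) where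
  lin : R
  trans : R

namespace Aff

variable {R : Type*} [CommRing R]

/-- The coordinates of an element of `Aff R`. -/
def equivProd (R : Type*) : Aff R ≃ R × R where
  toFun x := (x.lin, x.trans)
  invFun x := ⟨x.1, x.2⟩

instance : AddCommGroup (Aff R) := (equivProd R).addCommGroup

instance {K : Type*} [CommRing K] [Algebra K R] : Module K (Aff R) := (equivProd R).module K

instance : Bracket (Aff R) (Aff R) := ⟨fun x y => ⟨0, x.lin * y.trans - y.lin * x.trans⟩⟩

@[simp] lemma lin_add (x y : Aff R) : (x + y).lin = x.lin + y.lin := rfl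
@[simp] lemma trans_add (x y : Aff R) : (x + y).trans = x.trans + y.trans := rfl
@[simp] lemma lin_zero : (0 : Aff R).lin = 0 := rfl
@[simp] lemma trans_zero : (0 : Aff R).trans = 0 := rfl
@[simp] lemma lin_lie (x y : Aff R) : ⁅x, y⁆.lin = 0 := rfl
@[simp] lemma trans_lie (x y : Aff R) :
    ⁅x, y⁆.trans = x.lin * y.trans - y.lin * x.trans := rfl
@[simp] lemma lin_smul {K : Type*} [CommRing K] [Algebra K R] (c : K) (x : Aff R) :
    (c • x).lin = c • x.lin := rfl
@[simp] lemma trans_smul {K : Type*} [CommRing K] [Algebra K R] (c : K) (x : Aff R) :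
    (c • x).trans = c • x.trans := rfl

instance : LieRing (Aff R) where
  add_lie x y z := by ext <;> simp; ring
  lie_add x y z := by ext <;> simp; ring
  lie_self x := by ext <;> simp
  leibniz_lie x y z := by ext <;> simp; ring

instance {K : Type*} [CommRing K] [Algebra K R] : LieAlgebra K (Aff R) where
  lie_smul c x y := by ext <;> simp [smul_sub]

/-- The sum of the two coordinates of an element of `Aff R`. -/
def total (K : Type*) [CommRing K] [Algebra K R] : Aff R →ₗ[K] R where
  toFun x := x.lin + x.trans
  map_add' x y := by simp only [lin_add, trans_add]; ring
  map_smul' c x := by simp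

@[simp] lemma total_apply (K : Type*) [CommRing K] [Algebra K R] (x : Aff R) :
    total K x = x.lin + x.trans := rfl

end Aff

lemma _root_.FreeLieAlgebra.mem_lieSubalgebra_of_forall {R X : Type*} [CommRing R]
    (S : LieSubalgebra R (FreeLieAlgebra R X)) (hS : ∀ x, FreeLieAlgebra.of R x ∈ S)
    (z : FreeLieAlgebra R X) : z ∈ S := by
  have key : S.incl.comp (FreeLieAlgebra.lift R fun x => (⟨_, hS x⟩ : S)) = LieHom.id :=
    FreeLieAlgebra.hom_ext fun x => by simp
  have hz : ((FreeLieAlgebra.lift R (fun x => (⟨_, hS x⟩ : S)) z : S) : FreeLieAlgebra R X) = z :=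
    LieHom.congr_fun key z
  exact hz ▸ SetLike.coe_mem _

lemma lie_mem_of_mem_span {R L : Type*} [CommRing R] [LieRing L] [LieAlgebra R L] {S T : Set L}
    {P : Submodule R L} (h : ∀ x ∈ S, ∀ y ∈ T, ⁅x, y⁆ ∈ P) {x y : L}
    (hx : x ∈ Submodule.span R S) (hy : y ∈ Submodule.span R T) : ⁅x, y⁆ ∈ P := by
  induction hx, hy using Submodule.span_induction₂ with
  | mem_mem x y hx hy => exact h x hx y hy
  | zero_left => simp
  | zero_right => simp
  | add_left x y z _ _ _ h1 h2 => rw [add_lie]; exact add_mem h1 h2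
  | add_right x y z _ _ _ h1 h2 => rw [lie_add]; exact add_mem h1 h2
  | smul_left c x y _ _ h => rw [smul_lie]; exact Submodule.smul_mem _ _ h
  | smul_right c x y _ _ h => rw [lie_smul]; exact Submodule.smul_mem _ _ h

/-- The map from the free Lie algebra to the affine Lie algebra of the polynomial ring sending
each `a` to the multiplication by its variable and each `v` to the translation by its variable. -/
noncomputable def toAffFree : FreeLieAlgebra K (Idx p) →ₗ⁅K⁆ Aff (MvPolynomial (Idx p) K) :=
  FreeLieAlgebra.lift K fun x => match x with
    | .inl i => ⟨MvPolynomial.X (.inl i), 0⟩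
    | .inr i => ⟨0, MvPolynomial.X (.inr i)⟩

lemma lin_toAffFree_eq_zero {u : FreeLieAlgebra K (Idx p)} (hu : u ∈ vIdealFree K p) :
    (toAffFree K p u).lin = 0 := by
  induction hu using LieSubmodule.lieSpan_induction with
  | mem x hx => obtain ⟨i, rfl⟩ := hx; simp [toAffFree]
  | zero => simp
  | add x y _ _ hx hy => simp [hx, hy]
  | smul c x _ hx => simp [hx]
  | lie x y _ _ => simp

lemma relIdeal_le_ker : relIdeal K p ≤ (toAffFree K p).ker := by
  refine LieSubmodule.lieSpan_le.2 ?_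
  rintro z (⟨i, j, rfl⟩ | ⟨u, hu, w, hw, rfl⟩)
  · ext <;> simp [toAffFree]
  · simp only [SetLike.mem_coe, LieHom.mem_ker, LieHom.map_lie]
    ext <;> simp [lin_toAffFree_eq_zero K p hu, lin_toAffFree_eq_zero K p hw]

/-- The linear map `L_p → Aff K[a, v]` induced by `toAffFree`. -/
noncomputable def toAff : Lp K p →ₗ[K] Aff (MvPolynomial (Idx p) K) :=
  (relIdeal K p).toSubmodule.liftQ
    (toAffFree K p : FreeLieAlgebra K (Idx p) →ₗ[K] Aff (MvPolynomial (Idx p) K))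
    (fun _ hx => relIdeal_le_ker K p hx)

lemma toAff_lie (x y : Lp K p) : toAff K p ⁅x, y⁆ = ⁅toAff K p x, toAff K p y⁆ := by
  obtain ⟨x, rfl⟩ := LieSubmodule.Quotient.surjective_mk' _ x
  obtain ⟨y, rfl⟩ := LieSubmodule.Quotient.surjective_mk' _ y
  exact (toAffFree K p).map_lie x y

lemma toAff_aGen (i : (ZMod p)ˣ) : toAff K p (aGen K p i) = ⟨MvPolynomial.X (.inl i), 0⟩ :=
  FreeLieAlgebra.lift_of_apply ..

lemma toAff_vGen (i : (ZMod p)ˣ) : toAff K p (vGen K p i) = ⟨0, MvPolynomial.X (.inr i)⟩ :=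
  FreeLieAlgebra.lift_of_apply ..

lemma lie_aGen_aGen (i j : (ZMod p)ˣ) : ⁅aGen K p i, aGen K p j⁆ = 0 :=
  (LieSubmodule.Quotient.mk_eq_zero' (N := relIdeal K p)).2
    (LieSubmodule.subset_lieSpan (Or.inl ⟨i, j, rfl⟩))

instance leftCommutative_lie_aGen (g : (ZMod p)ˣ → (ZMod p)ˣ) :
    LeftCommutative fun (j : (ZMod p)ˣ) (x : Lp K p) => ⁅aGen K p (g j), x⁆ where
  left_comm i j x := by simp [leibniz_lie (aGen K p (g i)), lie_aGen_aGen]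

/-- The element `(∏_{j ∈ m} ad a_{sj}) v_s`. -/
noncomputable def vMon (s : (ZMod p)ˣ) (m : Multiset (ZMod p)ˣ) : Lp K p :=
  m.foldr (fun j x => ⁅aGen K p (s * j), x⁆) (vGen K p s)

@[simp] lemma vMon_zero (s : (ZMod p)ˣ) : vMon K p s 0 = vGen K p s := rfl

@[simp] lemma vMon_cons (s j : (ZMod p)ˣ) (m : Multiset (ZMod p)ˣ) :
    vMon K p s (j ::ₘ m) = ⁅aGen K p (s * j), vMon K p s m⁆ := Multiset.foldr_cons ..

lemma lie_aGen_vMon (s t : (ZMod p)ˣ) (m : Multiset (ZMod p)ˣ) :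
    ⁅aGen K p t, vMon K p s m⁆ = vMon K p s (s⁻¹ * t ::ₘ m) := by
  simp

lemma exists_mem_vIdealFree (s : (ZMod p)ˣ) (m : Multiset (ZMod p)ˣ) :
    ∃ u ∈ vIdealFree K p, LieSubmodule.Quotient.mk (N := relIdeal K p) u = vMon K p s m := by
  induction m using Multiset.induction with
  | empty => exact ⟨_, LieSubmodule.subset_lieSpan ⟨s, rfl⟩, rfl⟩
  | cons j m ih =>
    obtain ⟨u, hu, h⟩ := ih
    refine ⟨⁅FreeLieAlgebra.of K (.inl (s * j)), u⁆, LieSubmodule.lie_mem _ hu, ?_⟩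
    rw [vMon_cons, ← h]
    rfl

lemma lie_vMon_vMon (s t : (ZMod p)ˣ) (m n : Multiset (ZMod p)ˣ) :
    ⁅vMon K p s m, vMon K p t n⁆ = 0 := by
  obtain ⟨u, hu, h⟩ := exists_mem_vIdealFree K p s m
  obtain ⟨w, hw, h'⟩ := exists_mem_vIdealFree K p t n
  rw [← h, ← h', ← LieSubmodule.Quotient.mk_bracket]
  exact LieSubmodule.Quotient.mk_eq_zero'.2
    (LieSubmodule.subset_lieSpan (Or.inr ⟨u, hu, w, hw, rfl⟩))

/-- The monomial spanning family of `L_p`: the elements `a_s` and `(∏_{j ∈ m} ad a_{sj}) v_s`. -/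
noncomputable def bvec : (ZMod p)ˣ × Option (Multiset (ZMod p)ˣ) → Lp K p
  | (s, none) => aGen K p s
  | (s, some m) => vMon K p s m

lemma lie_bvec_mem_span (i j : (ZMod p)ˣ × Option (Multiset (ZMod p)ˣ)) :
    ⁅bvec K p i, bvec K p j⁆ ∈ Submodule.span K (Set.range (bvec K p)) := by
  rcases i with ⟨s, _ | m⟩ <;> rcases j with ⟨t, _ | n⟩ <;> simp only [bvec]
  · simp [lie_aGen_aGen]
  · rw [lie_aGen_vMon]
    exact Submodule.subset_span ⟨(t, some _), rfl⟩
  · rw [← lie_skew, lie_aGen_vMon]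
    exact Submodule.neg_mem _ (Submodule.subset_span ⟨(s, some _), rfl⟩)
  · simp [lie_vMon_vMon]

lemma span_bvec : ⊤ ≤ Submodule.span K (Set.range (bvec K p)) := by
  rintro z -
  obtain ⟨z, rfl⟩ := LieSubmodule.Quotient.surjective_mk' _ z
  let S : LieSubalgebra K (FreeLieAlgebra K (Idx p)) :=
    { (Submodule.span K (Set.range (bvec K p))).comap
        ((LieSubmodule.Quotient.mk' (relIdeal K p) : _ →ₗ[K] _)) with
      lie_mem' := by
        intro x y hx hy
        simp only [AddSubsemigroup.mem_carrier, AddSubmonoid.mem_toSubsemigroup,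
          Submodule.mem_toAddSubmonoid, Submodule.mem_comap] at hx hy ⊢
        change ⁅LieSubmodule.Quotient.mk (N := relIdeal K p) x,
          LieSubmodule.Quotient.mk (N := relIdeal K p) y⁆ ∈ _
        change LieSubmodule.Quotient.mk (N := relIdeal K p) x ∈ _ at hx
        change LieSubmodule.Quotient.mk (N := relIdeal K p) y ∈ _ at hy
        refine lie_mem_of_mem_span ?_ hx hy
        rintro _ ⟨i, rfl⟩ _ ⟨j, rfl⟩
        exact lie_bvec_mem_span K p i j }
  refine FreeLieAlgebra.mem_lieSubalgebra_of_forall S (fun x => ?_) z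
  rcases x with i | i
  · exact Submodule.subset_span ⟨(i, none), rfl⟩
  · exact Submodule.subset_span ⟨(i, some 0), rfl⟩

/-- The multiset of variables of the polynomial image of a monomial of `L_p`. -/
def vars : (ZMod p)ˣ × Option (Multiset (ZMod p)ˣ) → Multiset (Idx p)
  | (s, none) => {.inl s}
  | (s, some m) => .inr s ::ₘ m.map fun j => .inl (s * j)

lemma vars_injective : Function.Injective (vars p) := by
  have hcount : ∀ (s t : (ZMod p)ˣ) (m : Multiset (ZMod p)ˣ),
      (Sum.inr s : Idx p) ∈ vars p (t, some m) ↔ s = t := by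
    intro s t m; simp [vars]
  rintro ⟨s, _ | m⟩ ⟨t, _ | n⟩ h
  · simpa [vars] using h
  · have := (hcount t t n).2 rfl
    rw [← h] at this; simp [vars] at this
  · have := (hcount s s m).2 rfl
    rw [h] at this; simp [vars] at this
  · have hst : s = t := (hcount s t n).1 (h ▸ (hcount s s m).2 rfl)
    subst hst
    have hinj : Function.Injective fun j : (ZMod p)ˣ => (Sum.inl (s * j) : Idx p) := fun a b hab => by
      simpa using hab
    simp only [vars, Multiset.cons_inj_right] at h
    rw [Multiset.map_injective hinj h]

lemma toAff_vMon (s : (ZMod p)ˣ) (m : Multiset (ZMod p)ˣ) :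
    toAff K p (vMon K p s m) =
      ⟨0, MvPolynomial.monomial (Multiset.toFinsupp (vars p (s, some m))) 1⟩ := by
  induction m using Multiset.induction with
  | empty =>
    simp [toAff_vGen, vars, MvPolynomial.X]
  | cons j m ih =>
    have : (Sum.inr s : Idx p) ::ₘ Multiset.map (fun j => Sum.inl (s * j)) (j ::ₘ m) =
        {Sum.inl (s * j)} + (Sum.inr s ::ₘ Multiset.map (fun j => Sum.inl (s * j)) m) := by
      rw [Multiset.map_cons, Multiset.cons_swap, Multiset.singleton_add]
    rw [vMon_cons, toAff_lie, ih, toAff_aGen]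
    ext1
    · rfl
    · simp only [Aff.trans_lie, vars, this, mul_zero, sub_zero, map_add]
      simp [MvPolynomial.X, MvPolynomial.monomial_mul]

lemma total_toAff_bvec (i : (ZMod p)ˣ × Option (Multiset (ZMod p)ˣ)) :
    (Aff.total K ∘ₗ toAff K p) (bvec K p i) =
      MvPolynomial.monomial (Multiset.toFinsupp (vars p i)) 1 := by
  rcases i with ⟨s, _ | m⟩
  · simp [bvec, toAff_aGen, vars, MvPolynomial.X]
  · simp [bvec, toAff_vMon]

lemma linearIndependent_bvec : LinearIndependent K (bvec K p) := by
  refine LinearIndependent.of_comp (Aff.total K ∘ₗ toAff K p) ?_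
  have := (MvPolynomial.basisMonomials (Idx p) K).linearIndependent.comp
    (fun i => Multiset.toFinsupp (vars p i))
    (Multiset.toFinsupp.injective.comp (vars_injective p))
  rwa [show ⇑(MvPolynomial.basisMonomials (Idx p) K) ∘ (fun i => Multiset.toFinsupp (vars p i)) =
    ⇑(Aff.total K ∘ₗ toAff K p) ∘ bvec K p from
      funext fun i => by simpa using (total_toAff_bvec K p i).symm] at this

/-- The basis of `L_p` consisting of the monomials `bvec`. -/
noncomputable def monBasis :
    Module.Basis ((ZMod p)ˣ × Option (Multiset (ZMod p)ˣ)) K (Lp K p) :=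
  .mk (linearIndependent_bvec K p) (span_bvec K p)

@[simp] lemma coe_monBasis : ⇑(monBasis K p) = bvec K p := Module.Basis.coe_mk _ _

/-- The degree of the monomials `bvec K p (s, o)`. -/
def deg : Option (Multiset (ZMod p)ˣ) → ℕ
  | none => 1
  | some m => m.card + 1

/-- The span of the monomials of degree `k`. -/
noncomputable def gradedPiece (k : ℕ) : Submodule K (Lp K p) :=
  Submodule.span K (bvec K p '' {i | deg p i.2 = k})

lemma bvec_mem_gradedPiece {k : ℕ} (i : (ZMod p)ˣ × Option (Multiset (ZMod p)ˣ))
    (hi : deg p i.2 = k) : bvec K p i ∈ gradedPiece K p k :=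
  Submodule.subset_span ⟨i, hi, rfl⟩

lemma lie_mem_gradedPiece {k l : ℕ} {x y : Lp K p} (hx : x ∈ gradedPiece K p k)
    (hy : y ∈ gradedPiece K p l) : ⁅x, y⁆ ∈ gradedPiece K p (k + l) := by
  refine lie_mem_of_mem_span ?_ hx hy
  rintro _ ⟨⟨s, o⟩, hi, rfl⟩ _ ⟨⟨t, o'⟩, hj, rfl⟩
  rcases o with _ | m <;> rcases o' with _ | n <;>
    simp only [bvec, deg, Set.mem_ofPred_eq] at hi hj ⊢
  · simp [lie_aGen_aGen]
  · rw [lie_aGen_vMon]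
    exact bvec_mem_gradedPiece K p (t, some _) (by simp [deg]; omega)
  · rw [← lie_skew, lie_aGen_vMon]
    exact Submodule.neg_mem _ (bvec_mem_gradedPiece K p (s, some _) (by simp [deg]; omega))
  · simp [lie_vMon_vMon]

lemma gen_mem_gradedPiece (x : Idx p) : gen K p x ∈ gradedPiece K p 1 := by
  rcases x with i | i
  · exact bvec_mem_gradedPiece K p (i, none) rfl
  · exact bvec_mem_gradedPiece K p (i, some 0) rfl

lemma homog_le_gradedPiece (k : ℕ) : homog K p k ≤ gradedPiece K p k := by
  refine Submodule.span_le.2 ?_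
  rintro _ ⟨x, l, rfl, rfl⟩
  induction l using List.reverseRecOn with
  | nil => exact gen_mem_gradedPiece K p x
  | append_singleton l y ih =>
    rw [List.length_append, lnb, List.foldl_append]
    exact lie_mem_gradedPiece K p ih (gen_mem_gradedPiece K p y)

/-- The projection of `L_p` onto `gradedPiece K p k`. -/
noncomputable def gradedProj (k : ℕ) : Lp K p →ₗ[K] Lp K p :=
  (monBasis K p).constr K fun i => if deg p i.2 = k then bvec K p i else 0

lemma gradedProj_bvec (k : ℕ) (i : (ZMod p)ˣ × Option (Multiset (ZMod p)ˣ)) :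
    gradedProj K p k (bvec K p i) = if deg p i.2 = k then bvec K p i else 0 := by
  rw [← coe_monBasis, gradedProj, Module.Basis.constr_basis, coe_monBasis]

lemma gradedProj_of_mem {k l : ℕ} {x : Lp K p} (hx : x ∈ gradedPiece K p l) :
    gradedProj K p k x = if l = k then x else 0 := by
  induction hx using Submodule.span_induction with
  | mem x hx =>
    obtain ⟨i, rfl, rfl⟩ := hx
    exact gradedProj_bvec K p k i
  | zero => simp
  | add x y _ _ hx hy => rw [map_add, hx, hy]; split_ifs <;> simp
  | smul c x _ hx => rw [map_smul, hx]; split_ifs <;> simp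

/-- A span of homogeneous elements meets the degree-`k` part in the span of those of degree `k`. -/
lemma span_inf_homog_le {ι : Type*} (t : ι → Lp K p) (d : ι → ℕ)
    (ht : ∀ i, t i ∈ gradedPiece K p (d i)) (k : ℕ) :
    Submodule.span K (Set.range t) ⊓ homog K p k ≤ Submodule.span K (t '' {i | d i = k}) := by
  rintro x ⟨hx, hk⟩
  have hxk : gradedProj K p k x = x := by
    simpa using gradedProj_of_mem K p (k := k) (homog_le_gradedPiece K p k hk)
  have hle : Submodule.span K (Set.range t) ≤
      (Submodule.span K (t '' {i | d i = k})).comap (gradedProj K p k) := by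
    refine Submodule.span_le.2 ?_
    rintro _ ⟨i, rfl⟩
    rw [SetLike.mem_coe, Submodule.mem_comap, gradedProj_of_mem K p (ht i)]
    split_ifs with h
    · exact Submodule.subset_span ⟨i, h, rfl⟩
    · exact zero_mem _
  exact hxk ▸ hle hx

/-- The exponent `w` such that `f (bvec K p (s, o)) = ω ^ (s * w) • bvec K p (s, o)`. -/
def weight : Option (Multiset (ZMod p)ˣ) → ZMod p
  | none => 1
  | some m => 1 + (m.map fun j : (ZMod p)ˣ => (j : ZMod p)).sum

section Automorphisms

variable {K p}

lemma map_bvec_perm {r : (ZMod p)ˣ} {h : Lp K p ≃ₗ⁅K⁆ Lp K p}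
    (hha : ∀ i : (ZMod p)ˣ, h (aGen K p i) = aGen K p (r * i))
    (hhv : ∀ i : (ZMod p)ˣ, h (vGen K p i) = vGen K p (r * i))
    (s : (ZMod p)ˣ) (o : Option (Multiset (ZMod p)ˣ)) :
    h (bvec K p (s, o)) = bvec K p (r * s, o) := by
  rcases o with _ | m
  · exact hha s
  · simp only [bvec]
    induction m using Multiset.induction with
    | empty => exact hhv s
    | cons j m ih => rw [vMon_cons, vMon_cons, LieEquiv.map_lie, ih, hha, mul_assoc]

lemma map_bvec_diag {χ : AddChar (ZMod p) K} {f : Lp K p ≃ₗ⁅K⁆ Lp K p}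
    (hfa : ∀ i : (ZMod p)ˣ, f (aGen K p i) = χ i • aGen K p i)
    (hfv : ∀ i : (ZMod p)ˣ, f (vGen K p i) = χ i • vGen K p i)
    (s : (ZMod p)ˣ) (o : Option (Multiset (ZMod p)ˣ)) :
    f (bvec K p (s, o)) = χ (s * weight p o) • bvec K p (s, o) := by
  rcases o with _ | m
  · simpa [bvec, weight] using hfa s
  · simp only [bvec, weight]
    induction m using Multiset.induction with
    | empty => simpa using hfv s
    | cons j m ih =>
      rw [vMon_cons, LieEquiv.map_lie, ih, hfa, smul_lie, lie_smul, smul_smul, ← χ.map_add_eq_mul]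
      congr 2
      simp
      ring

lemma mk_indices_le [Fact p.Prime] {k : ℕ} (hk : 2 ≤ k) :
    Cardinal.mk {x : ZMod p × List (ZMod p)ˣ × Multiset (ZMod p)ˣ |
        x.2.1.length + 2 + x.2.2.card = k} ≤
      ((p * ∑ j ∈ Finset.range (k - 1),
        (p - 1) ^ (k - 2 - j) * Nat.choose (j + p - 2) j : ℕ) : Cardinal) := by
  have hp := (Fact.out : p.Prime).two_le
  let F : ZMod p × (Σ d : Fin (k - 1), List.Vector (ZMod p)ˣ (k - 2 - d) × Sym (ZMod p)ˣ d) →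
      ZMod p × List (ZMod p)ˣ × Multiset (ZMod p)ˣ :=
    fun y => (y.1, y.2.2.1.1, y.2.2.2.1)
  have hsub : {x : ZMod p × List (ZMod p)ˣ × Multiset (ZMod p)ˣ |
      x.2.1.length + 2 + x.2.2.card = k} ⊆ Set.range F := by
    rintro ⟨c, l, m⟩ hx
    simp only [Set.mem_ofPred_eq] at hx
    exact ⟨(c, ⟨⟨m.card, by omega⟩, ⟨l, by simp; omega⟩, ⟨m, rfl⟩⟩), rfl⟩
  refine (Cardinal.mk_le_mk_of_subset hsub).trans (Cardinal.mk_range_le.trans ?_)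
  rw [Cardinal.mk_fintype, Fintype.card_prod, ZMod.card, Fintype.card_sigma, Finset.sum_range]
  refine le_of_eq ?_
  congr 2
  refine Finset.sum_congr rfl fun d _ => ?_
  rw [Fintype.card_prod, card_vector, Sym.card_sym_eq_choose, ZMod.card_units]
  congr 2
  omega

section Ideal

variable [NeZero p]

/-- The image under `f ^ c` of the orbit sum of the monomial `bvec K p (1, o)`. -/
noncomputable def orbitSum (χ : AddChar (ZMod p) K) (c : ZMod p)
    (o : Option (Multiset (ZMod p)ˣ)) : Lp K p :=
  ∑ s : (ZMod p)ˣ, χ (c * (s * weight p o)) • bvec K p (s, o)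

lemma map_orbitSum_perm (χ : AddChar (ZMod p) K) {r : (ZMod p)ˣ} {h : Lp K p ≃ₗ⁅K⁆ Lp K p}
    (hha : ∀ i : (ZMod p)ˣ, h (aGen K p i) = aGen K p (r * i))
    (hhv : ∀ i : (ZMod p)ˣ, h (vGen K p i) = vGen K p (r * i))
    (c : ZMod p) (o : Option (Multiset (ZMod p)ˣ)) :
    h (orbitSum χ c o) = orbitSum χ (c * (r⁻¹ : (ZMod p)ˣ)) o := by
  simp only [orbitSum, map_sum, map_smul, map_bvec_perm hha hhv]
  refine Fintype.sum_equiv (Equiv.mulLeft r) _ _ fun s => ?_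
  have : (c * ((r⁻¹ : (ZMod p)ˣ) : ZMod p)) * (((r * s : (ZMod p)ˣ) : ZMod p) * weight p o) =
      c * (s * weight p o) := by
    calc _ = c * (((r⁻¹ * r * s : (ZMod p)ˣ) : ZMod p) * weight p o) := by push_cast; ring
      _ = _ := by rw [inv_mul_cancel, one_mul]
  rw [Equiv.coe_mulLeft, this]

lemma map_orbitSum_diag {χ : AddChar (ZMod p) K} {f : Lp K p ≃ₗ⁅K⁆ Lp K p}
    (hfa : ∀ i : (ZMod p)ˣ, f (aGen K p i) = χ i • aGen K p i)
    (hfv : ∀ i : (ZMod p)ˣ, f (vGen K p i) = χ i • vGen K p i)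
    (c : ZMod p) (o : Option (Multiset (ZMod p)ˣ)) :
    f (orbitSum χ c o) = orbitSum χ (c + 1) o := by
  simp only [orbitSum, map_sum, map_smul, map_bvec_diag hfa hfv, smul_smul,
    ← χ.map_add_eq_mul, add_mul, one_mul]

lemma orbitSum_mem_gradedPiece (χ : AddChar (ZMod p) K) (c : ZMod p)
    (o : Option (Multiset (ZMod p)ˣ)) : orbitSum χ c o ∈ gradedPiece K p (deg p o) :=
  Submodule.sum_mem _ fun s _ => Submodule.smul_mem _ _ (bvec_mem_gradedPiece K p (s, o) rfl)

lemma fixedSubmodule_le {r : (ZMod p)ˣ} (hr : Subgroup.zpowers r = ⊤) {h : Lp K p ≃ₗ⁅K⁆ Lp K p}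
    (hha : ∀ i : (ZMod p)ˣ, h (aGen K p i) = aGen K p (r * i))
    (hhv : ∀ i : (ZMod p)ˣ, h (vGen K p i) = vGen K p (r * i)) (χ : AddChar (ZMod p) K) :
    fixedSubmodule K p h ≤ Submodule.span K (Set.range (orbitSum χ 0)) := by
  intro x hx
  replace hx : h x = x := hx
  set c := (monBasis K p).repr x with hc
  have hcr : ∀ s o, c (r * s, o) = c (s, o) := by
    intro s o
    have key : Finsupp.lapply (r * s, o) ∘ₗ (monBasis K p).repr.toLinearMap ∘ₗ
        (h.toLinearEquiv : Lp K p →ₗ[K] Lp K p) =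
        Finsupp.lapply (s, o) ∘ₗ (monBasis K p).repr.toLinearMap := by
      refine (monBasis K p).ext fun ⟨t, o'⟩ => ?_
      have h1 : h.toLinearEquiv (monBasis K p (t, o')) = monBasis K p (r * t, o') := by
        simpa using map_bvec_perm hha hhv t o'
      simp [-coe_monBasis, h1, Finsupp.single_apply]
    have := LinearMap.congr_fun key x
    have h2 : h.toLinearEquiv x = x := hx
    simpa [h2] using this
  have hc1 : ∀ s o, c (s, o) = c (1, o) := by
    intro s o
    have hs : s ∈ Subgroup.zpowers r := hr ▸ Subgroup.mem_top s
    have hs' : s ∈ Submonoid.powers r := (mem_powers_iff_mem_zpowers).2 hs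
    obtain ⟨n, rfl⟩ := hs'
    induction n with
    | zero => simp
    | succ n ih =>
      simp only [pow_succ', hcr] at ih ⊢
      exact ih (hr ▸ Subgroup.mem_top _)
  have hsum : x = ∑ o ∈ c.support.image Prod.snd, c (1, o) • orbitSum χ 0 o := by
    calc x = ∑ i ∈ c.support, c i • bvec K p i := by
          conv_lhs => rw [← (monBasis K p).linearCombination_repr x]
          rw [Finsupp.linearCombination_apply, coe_monBasis]
          rfl
      _ = ∑ i ∈ Finset.univ ×ˢ c.support.image Prod.snd, c i • bvec K p i := by
          refine Finset.sum_subset (fun i hi => ?_) (fun i _ hi => ?_)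
          · simpa using ⟨i.1, by simpa using hi⟩
          · simp [Finsupp.notMem_support_iff.1 hi]
      _ = ∑ o ∈ c.support.image Prod.snd, ∑ s, c (s, o) • bvec K p (s, o) :=
          Finset.sum_product_right ..
      _ = _ := by simp [orbitSum, Finset.smul_sum, hc1]
  rw [hsum]
  exact Submodule.sum_mem _ fun o _ => Submodule.smul_mem _ _ (Submodule.subset_span ⟨o, rfl⟩)

/-- The spanning elements `[a_{l₁}, …, [a_{lₙ}, [f^c a, f^c w_m]]]` of the ideal `J_p`, where `a` and
`w_m` are the orbit sums of `a_1` and of the monomial of `m`. -/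
noncomputable def jGen (χ : AddChar (ZMod p) K)
    (x : ZMod p × List (ZMod p)ˣ × Multiset (ZMod p)ˣ) : Lp K p :=
  x.2.1.foldr (fun j z => ⁅aGen K p j, z⁆) ⁅orbitSum χ x.1 none, orbitSum χ x.1 (some x.2.2)⁆

lemma jGen_cons (χ : AddChar (ZMod p) K) (c : ZMod p) (j : (ZMod p)ˣ) (l : List (ZMod p)ˣ)
    (m : Multiset (ZMod p)ˣ) : jGen χ (c, j :: l, m) = ⁅aGen K p j, jGen χ (c, l, m)⁆ := rfl

lemma jGen_mem_gradedPiece (χ : AddChar (ZMod p) K)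
    (x : ZMod p × List (ZMod p)ˣ × Multiset (ZMod p)ˣ) :
    jGen χ x ∈ gradedPiece K p (x.2.1.length + 2 + x.2.2.card) := by
  obtain ⟨c, l, m⟩ := x
  dsimp only
  induction l with
  | nil =>
    convert lie_mem_gradedPiece K p (orbitSum_mem_gradedPiece χ c none)
      (orbitSum_mem_gradedPiece χ c (some m)) using 1
    · simp only [deg, List.length_nil]
      congr 1
      omega
    · rfl
  | cons j l ih =>
    convert lie_mem_gradedPiece K p (gen_mem_gradedPiece K p (.inl j)) ih using 1
    · rw [List.length_cons]
      congr 1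
      omega
    · rfl

lemma lie_vMon_jGen (χ : AddChar (ZMod p) K) (s : (ZMod p)ˣ) (n : Multiset (ZMod p)ˣ)
    (x : ZMod p × List (ZMod p)ˣ × Multiset (ZMod p)ˣ) : ⁅vMon K p s n, jGen χ x⁆ = 0 := by
  have hskew : ∀ (t s : (ZMod p)ˣ) (n : Multiset (ZMod p)ˣ),
      ⁅vMon K p s n, aGen K p t⁆ = -vMon K p s (s⁻¹ * t ::ₘ n) := fun t s n => by
    rw [← lie_skew, lie_aGen_vMon]
  obtain ⟨c, l, m⟩ := x
  induction l generalizing s n with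
  | nil =>
    have hs : ∀ s n, ⁅vMon K p s n, orbitSum χ c (some m)⁆ = 0 := fun s n => by
      simp [orbitSum, bvec, lie_sum, lie_vMon_vMon]
    have ha : ⁅⁅vMon K p s n, orbitSum χ c none⁆, orbitSum χ c (some m)⁆ = 0 := by
      simp only [orbitSum.eq_1 χ c none, bvec, lie_sum, lie_smul, hskew, sum_lie,
        smul_lie, neg_lie, hs, neg_zero, smul_zero, Finset.sum_const_zero]
    change ⁅vMon K p s n, ⁅orbitSum χ c none, orbitSum χ c (some m)⁆⁆ = 0
    rw [leibniz_lie, ha, hs, lie_zero, add_zero]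
  | cons j l ih => rw [jGen_cons, leibniz_lie, hskew, neg_lie, ih, ih, lie_zero, neg_zero, add_zero]

/-- The Lie ideal spanned by the elements `jGen`. -/
noncomputable def jSpan (χ : AddChar (ZMod p) K) : LieIdeal K (Lp K p) :=
  { Submodule.span K (Set.range (jGen χ)) with
    lie_mem := by
      intro x y hy
      refine lie_mem_of_mem_span (S := Set.range (bvec K p)) ?_
        (span_bvec K p Submodule.mem_top) hy
      rintro _ ⟨⟨s, _ | n⟩, rfl⟩ _ ⟨⟨c, l, m⟩, rfl⟩
      · exact Submodule.subset_span ⟨(c, s :: l, m), rfl⟩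
      · simp only [bvec, lie_vMon_jGen]
        exact zero_mem _ }

lemma toSubmodule_jSpan (χ : AddChar (ZMod p) K) :
    (jSpan χ).toSubmodule = Submodule.span K (Set.range (jGen χ)) := rfl

lemma derivedFixed_le_jSpan {r : (ZMod p)ˣ} (hr : Subgroup.zpowers r = ⊤)
    {h : Lp K p ≃ₗ⁅K⁆ Lp K p}
    (hha : ∀ i : (ZMod p)ˣ, h (aGen K p i) = aGen K p (r * i))
    (hhv : ∀ i : (ZMod p)ˣ, h (vGen K p i) = vGen K p (r * i)) (χ : AddChar (ZMod p) K)
    {z : Lp K p} (hz : z ∈ derivedFixed K p h) : z ∈ jSpan χ := by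
  refine (LieSubalgebra.lieSpan_le (K := (jSpan χ : LieSubalgebra K (Lp K p)))).2 ?_ hz
  rintro _ ⟨x, hx, y, hy, rfl⟩
  refine lie_mem_of_mem_span (P := (jSpan χ).toSubmodule) ?_
    (fixedSubmodule_le hr hha hhv χ hx) (fixedSubmodule_le hr hha hhv χ hy)
  rintro _ ⟨_ | m, rfl⟩ _ ⟨_ | n, rfl⟩
  · simp
  · exact Submodule.subset_span ⟨(0, [], n), rfl⟩
  · rw [← lie_skew]
    exact Submodule.neg_mem _ (Submodule.subset_span ⟨(0, [], m), rfl⟩)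
  · simp [orbitSum, bvec, lie_sum, sum_lie, lie_vMon_vMon]

lemma map_jGen_perm (χ : AddChar (ZMod p) K) {r : (ZMod p)ˣ} {h : Lp K p ≃ₗ⁅K⁆ Lp K p}
    (hha : ∀ i : (ZMod p)ˣ, h (aGen K p i) = aGen K p (r * i))
    (hhv : ∀ i : (ZMod p)ˣ, h (vGen K p i) = vGen K p (r * i))
    (x : ZMod p × List (ZMod p)ˣ × Multiset (ZMod p)ˣ) :
    h (jGen χ x) = jGen χ (x.1 * (r⁻¹ : (ZMod p)ˣ), x.2.1.map (r * ·), x.2.2) := by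
  obtain ⟨c, l, m⟩ := x
  dsimp only
  induction l with
  | nil =>
    simp only [jGen, List.foldr_nil, List.map_nil, LieEquiv.map_lie, map_orbitSum_perm χ hha hhv]
  | cons j l ih => rw [jGen_cons, LieEquiv.map_lie, hha, ih, List.map_cons, jGen_cons]

lemma map_jGen_diag {χ : AddChar (ZMod p) K} {f : Lp K p ≃ₗ⁅K⁆ Lp K p}
    (hfa : ∀ i : (ZMod p)ˣ, f (aGen K p i) = χ i • aGen K p i)
    (hfv : ∀ i : (ZMod p)ˣ, f (vGen K p i) = χ i • vGen K p i)
    (x : ZMod p × List (ZMod p)ˣ × Multiset (ZMod p)ˣ) :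
    f (jGen χ x) ∈ Submodule.span K {jGen χ (x.1 + 1, x.2)} := by
  obtain ⟨c, l, m⟩ := x
  dsimp only
  rw [Submodule.mem_span_singleton]
  induction l with
  | nil =>
    refine ⟨1, ?_⟩
    simp only [jGen, List.foldr_nil, LieEquiv.map_lie, map_orbitSum_diag hfa hfv, one_smul]
  | cons j l ih =>
    obtain ⟨a, ha⟩ := ih
    refine ⟨a * χ j, ?_⟩
    rw [jGen_cons χ c, LieEquiv.map_lie, hfa, ← ha, jGen_cons, smul_lie, lie_smul, smul_smul, mul_comm]

lemma Jp_le_jSpan {χ : AddChar (ZMod p) K} {r : (ZMod p)ˣ} (hr : Subgroup.zpowers r = ⊤)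
    {f h : Lp K p ≃ₗ⁅K⁆ Lp K p}
    (hfa : ∀ i : (ZMod p)ˣ, f (aGen K p i) = χ i • aGen K p i)
    (hfv : ∀ i : (ZMod p)ˣ, f (vGen K p i) = χ i • vGen K p i)
    (hha : ∀ i : (ZMod p)ˣ, h (aGen K p i) = aGen K p (r * i))
    (hhv : ∀ i : (ZMod p)ˣ, h (vGen K p i) = vGen K p (r * i)) :
    Jp K p f h ≤ jSpan χ := by
  have hmap : ∀ e : Lp K p ≃ₗ⁅K⁆ Lp K p, (∀ i, e (jGen χ i) ∈ jSpan χ) →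
      ∀ x ∈ jSpan χ, e x ∈ jSpan χ := by
    intro e he x hx
    have hle : Submodule.span K (Set.range (jGen χ)) ≤
        (jSpan χ).toSubmodule.comap (e.toLinearEquiv : Lp K p →ₗ[K] Lp K p) :=
      Submodule.span_le.2 (by rintro _ ⟨i, rfl⟩; exact he i)
    exact hle hx
  refine sInf_le ⟨fun z hz => derivedFixed_le_jSpan hr hha hhv χ hz, hmap f fun i => ?_,
    hmap h fun i => ?_⟩
  · exact Submodule.span_mono (Set.singleton_subset_iff.2 (Set.mem_range_self _))
      (map_jGen_diag hfa hfv i)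
  · rw [map_jGen_perm χ hha hhv]
    exact Submodule.subset_span (Set.mem_range_self _)

end Ideal

end Automorphisms

/-- **Proposition 4.2.** `J_p ∩ L_{p,1} = 0` and, for every `k ≥ 2`,
`dim (J_p ∩ L_{p,k}) ≤ p · Σ_{j=0}^{k−2} (p−1)^{k−2−j} · C(j+p−2, j)`. -/
theorem rank_Jp_inter_homog (K : Type) [Field K] (p : ℕ) [Fact p.Prime]
    (hchar : ¬ (ringChar K ∣ p)) (ω : K) (hω : IsPrimitiveRoot ω p)
    (r : (ZMod p)ˣ) (hr : Subgroup.zpowers r = ⊤)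
    (f h : Lp K p ≃ₗ⁅K⁆ Lp K p)
    (hfa : ∀ i : (ZMod p)ˣ, f (aGen K p i) = ω ^ ((i : ZMod p)).val • aGen K p i)
    (hfv : ∀ i : (ZMod p)ˣ, f (vGen K p i) = ω ^ ((i : ZMod p)).val • vGen K p i)
    (hha : ∀ i : (ZMod p)ˣ, h (aGen K p i) = aGen K p (r * i))
    (hhv : ∀ i : (ZMod p)ˣ, h (vGen K p i) = vGen K p (r * i)) :
    (Jp K p f h).toSubmodule ⊓ homog K p 1 = ⊥ ∧
    ∀ k : ℕ, 2 ≤ k →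
      Module.rank K ((Jp K p f h).toSubmodule ⊓ homog K p k : Submodule K (Lp K p))
        ≤ ((p * ∑ j ∈ Finset.range (k - 1),
              (p - 1) ^ (k - 2 - j) * Nat.choose (j + p - 2) j : ℕ) : Cardinal) := by
  have hle : ∀ k, (Jp K p f h).toSubmodule ⊓ homog K p k ≤ Submodule.span K
      (jGen (AddChar.zmodChar p hω.pow_eq_one) '' {x | x.2.1.length + 2 + x.2.2.card = k}) :=
    fun k => le_trans (inf_le_inf_right _ (Jp_le_jSpan hr hfa hfv hha hhv))
      (span_inf_homog_le K p _ _ (jGen_mem_gradedPiece _) k)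
  refine ⟨?_, fun k hk => ?_⟩
  · refine le_bot_iff.1 ((hle 1).trans ?_)
    rw [show {x : ZMod p × List (ZMod p)ˣ × Multiset (ZMod p)ˣ |
      x.2.1.length + 2 + x.2.2.card = 1} = ∅ from Set.eq_empty_iff_forall_notMem.2 fun x hx => by
        have : x.2.1.length + 2 + x.2.2.card = 1 := hx
        omega]
    simp
  · exact (Submodule.rank_mono (hle k)).trans <| (rank_span_le _).trans <|
      Cardinal.mk_image_le.trans (mk_indices_le hk)

end Paper
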